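/- arXiv:2501.08596 — 5 statements merged into one kernel-verified Lean document; each statement's English description precedes it below -/
import Mathlib

section
/- Let 𝕋 be a time scale, let α ∈ (0,1], and let t ∈ 𝕋^k be left-dense. If f : 𝕋 → ℝ is nabla fractional differentiable of order α at t, then f is continuous at t when α ∈ Q, respectively left-continuous at t when α ∉ Q. -/
open Set Filter
open scoped Classical

/-- Backward jump operator on a time scale `T`. -/
noncomputable def rho (T : Set ℝ) (t : ℝ) : ℝ :=
  if ({s ∈ T | s < t}).Nonempty then sSup {s ∈ T | s < t} else t

/-- Forward jump operator on a time scale `T`. -/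
noncomputable def sigmaTS (T : Set ℝ) (t : ℝ) : ℝ :=
  if ({s ∈ T | t < s}).Nonempty then sInf {s ∈ T | t < s} else t

/-- Graininess `ν(t) = t - ρ(t)`. -/
noncomputable def nu (T : Set ℝ) (t : ℝ) : ℝ := t - rho T t

/-- `𝕋^k`: remove the minimum of `T` when it exists and is right-scattered. -/
def Tk (T : Set ℝ) : Set ℝ :=
  {t ∈ T | ¬ (IsLeast T t ∧ t < sigmaTS T t)}

/-- The set `Q = {1/q : q an odd positive integer}`. -/
def QOdd : Set ℝ := {x : ℝ | ∃ q : ℕ, Odd q ∧ 0 < q ∧ x = 1 / (q : ℝ)}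

/-- Real odd root power: `sign(x) * |x| ^ α`. -/
noncomputable def oddPow (α x : ℝ) : ℝ := Real.sign x * |x| ^ α

/-- The power `x ^ α` used in nabla fractional differentiation: the real odd
root when `α ∈ QOdd`, the usual real power otherwise. -/
noncomputable def fpow (α x : ℝ) : ℝ := if α ∈ QOdd then oddPow α x else x ^ α

/-- The neighborhood of `t` used in the definition of the nabla fractional
derivative: `U_δ(t)` when `α ∈ QOdd`, `U_δ⁻(t)` otherwise. -/
noncomputable def Unbhd (T : Set ℝ) (α t δ : ℝ) : Set ℝ :=
  if α ∈ QOdd then Ioo (t - δ) (t + δ) ∩ T else Ioo (t - δ) t ∩ T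

/-- `f` is nabla fractional differentiable of order `α` at `t ∈ T^k` with
derivative `L`. -/
def nablaDiffAt (T : Set ℝ) (α : ℝ) (f : ℝ → ℝ) (t L : ℝ) : Prop :=
  ∀ ε > 0, ∃ δ > 0, ∀ s ∈ Unbhd T α t δ,
    |(f (rho T t) - f s) - L * fpow α (rho T t - s)| ≤ ε * |rho T t - s| ^ α

/-- `f` is continuous at `t` in the time-scale sense. -/
def contAt (T : Set ℝ) (f : ℝ → ℝ) (t : ℝ) : Prop :=
  ∀ ε > 0, ∃ δ > 0, ∀ s ∈ Ioo (t - δ) (t + δ) ∩ T, |f t - f s| < ε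

/-- `f` is left-continuous at `t` in the time-scale sense. -/
def leftContAt (T : Set ℝ) (f : ℝ → ℝ) (t : ℝ) : Prop :=
  ∀ ε > 0, ∃ δ > 0, ∀ s ∈ Ioo (t - δ) t ∩ T, |f t - f s| < ε

/-- `f` has a local left-maximum at `t₀`. -/
def localLeftMax (T : Set ℝ) (f : ℝ → ℝ) (t₀ : ℝ) : Prop :=
  (rho T t₀ < t₀ → f (rho T t₀) ≤ f t₀) ∧
  (rho T t₀ = t₀ → ∃ δ > 0, ∀ s ∈ Ioo (t₀ - δ) t₀ ∩ T, f s ≤ f t₀)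

/-- `f` has a local left-minimum at `t₀`. -/
def localLeftMin (T : Set ℝ) (f : ℝ → ℝ) (t₀ : ℝ) : Prop :=
  (rho T t₀ < t₀ → f t₀ ≤ f (rho T t₀)) ∧
  (rho T t₀ = t₀ → ∃ δ > 0, ∀ s ∈ Ioo (t₀ - δ) t₀ ∩ T, f t₀ ≤ f s)

theorem abs_fpow_le (α x : ℝ) : |fpow α x| ≤ |x| ^ α := by
  unfold fpow oddPow
  split_ifs
  · have hsign : |Real.sign x| ≤ 1 := by
      rcases Real.sign_apply_eq x with h | h | h <;> simp [h]
    have hpow : 0 ≤ |x| ^ α := Real.rpow_nonneg (abs_nonneg x) α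
    rw [abs_mul, abs_of_nonneg hpow]
    exact mul_le_of_le_one_left hpow hsign
  · exact Real.abs_rpow_le_abs_rpow x α

theorem Unbhd_mono (T : Set ℝ) (α t : ℝ) {δ δ' : ℝ} (h : δ ≤ δ') :
    Unbhd T α t δ ⊆ Unbhd T α t δ' := by
  unfold Unbhd
  split_ifs
  · exact inter_subset_inter_left _ (Ioo_subset_Ioo (by linarith) (by linarith))
  · exact inter_subset_inter_left _ (Ioo_subset_Ioo (by linarith) le_rfl)

theorem abs_sub_lt_of_mem_Unbhd {T : Set ℝ} {α t δ s : ℝ}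
    (hs : s ∈ Unbhd T α t δ) : |t - s| < δ := by
  unfold Unbhd at hs
  split_ifs at hs <;> obtain ⟨⟨h₁, h₂⟩, -⟩ := hs <;>
    exact abs_lt.mpr ⟨by linarith, by linarith⟩

/-- At a left-dense point, nabla fractional differentiability forces `f s → f t` along the
neighborhoods used in the definition of the derivative. -/
theorem nablaDiffAt.exists_forall_abs_sub_lt {T : Set ℝ} {α t L : ℝ} {f : ℝ → ℝ}
    (hdiff : nablaDiffAt T α f t L) (hα : 0 < α) (hdense : rho T t = t) {ε : ℝ} (hε : 0 < ε) :
    ∃ δ > 0, ∀ s ∈ Unbhd T α t δ, |f t - f s| < ε := by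
  obtain ⟨δ, hδ, hbound⟩ := hdiff 1 one_pos
  rw [hdense] at hbound
  have hL : 0 < 1 + |L| := by positivity
  have hη : 0 < (ε / (1 + |L|)) ^ α⁻¹ := by positivity
  refine ⟨min δ ((ε / (1 + |L|)) ^ α⁻¹), lt_min hδ hη, fun s hs => ?_⟩
  have hb := hbound s (Unbhd_mono T α t (min_le_left _ _) hs)
  have hpow : |t - s| ^ α < ε / (1 + |L|) := by
    have h := Real.rpow_lt_rpow (abs_nonneg _)
      ((abs_sub_lt_of_mem_Unbhd hs).trans_le (min_le_right _ _)) hα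
    rwa [Real.rpow_inv_rpow (by positivity) hα.ne'] at h
  rw [lt_div_iff₀ hL] at hpow
  calc |f t - f s|
      = |(f t - f s - L * fpow α (t - s)) + L * fpow α (t - s)| := by rw [sub_add_cancel]
    _ ≤ |f t - f s - L * fpow α (t - s)| + |L| * |fpow α (t - s)| := by
        rw [← abs_mul]; exact abs_add_le _ _
    _ ≤ 1 * |t - s| ^ α + |L| * |t - s| ^ α := by
        gcongr; exact abs_fpow_le _ _
    _ < ε := by linarith

/-- If `t ∈ 𝕋^k` is left-dense and `f` is nabla fractional
differentiable of order `α` at `t`, then `f` is continuous at `t` when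
`α ∈ Q`, respectively left-continuous at `t` when `α ∉ Q`. -/
theorem stmt0 (T : Set ℝ) (hTne : T.Nonempty) (hTcl : IsClosed T)
    (α : ℝ) (hα : α ∈ Set.Ioc (0 : ℝ) 1)
    (t : ℝ) (ht : t ∈ Tk T) (hdense : rho T t = t)
    (f : ℝ → ℝ) (L : ℝ) (hdiff : nablaDiffAt T α f t L) :
    (α ∈ QOdd → contAt T f t) ∧ (α ∉ QOdd → leftContAt T f t) := by
  have key := fun ε (hε : (0 : ℝ) < ε) =>
    hdiff.exists_forall_abs_sub_lt hα.1 hdense hε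
  refine ⟨fun hQ ε hε => ?_, fun hQ ε hε => ?_⟩
  · simpa only [Unbhd, if_pos hQ] using key ε hε
  · simpa only [Unbhd, if_neg hQ] using key ε hε
end

section
/- Let 𝕋 be a time scale, let α ∈ (0,1], and let t ∈ 𝕋^k be left-scattered. If f : 𝕋 → ℝ is continuous at t, then f is nabla fractional differentiable of order α at t with ∇^(α)f(t) = (f(t) − f(ρ(t))) / (ν(t))^α. -/
open Set Filter
open scoped Classical

theorem le_rho {T : Set ℝ} {s t : ℝ} (hs : s ∈ T) (hst : s < t) : s ≤ rho T t := by
  have hmem : s ∈ {s ∈ T | s < t} := ⟨hs, hst⟩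
  rw [rho, if_pos ⟨s, hmem⟩]
  exact le_csSup ⟨t, fun _ hx => hx.2.le⟩ hmem

theorem fpow_of_neg_of_mem {α x : ℝ} (hα : α ∈ QOdd) (hx : x < 0) :
    fpow α x = -|x| ^ α := by
  rw [fpow, if_pos hα, oddPow, Real.sign_of_neg hx, neg_one_mul]

/-- If `t ∈ 𝕋^k` is left-scattered and `f` is continuous at `t`,
then `f` is nabla fractional differentiable of order `α` at `t` with
derivative `(f t - f (ρ t)) / (ν t) ^ α`. -/
theorem stmt1 (T : Set ℝ) (hTne : T.Nonempty) (hTcl : IsClosed T)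
    (α : ℝ) (hα : α ∈ Set.Ioc (0 : ℝ) 1)
    (t : ℝ) (ht : t ∈ Tk T) (hscat : rho T t < t)
    (f : ℝ → ℝ) (hcont : contAt T f t) :
    nablaDiffAt T α f t ((f t - f (rho T t)) / (nu T t) ^ α) := by
  intro ε hε
  by_cases hQ : α ∈ QOdd
  · set r := rho T t
    set L := (f t - f r) / (nu T t) ^ α with hL
    set g : ℝ → ℝ := fun s => |r - s| ^ α with hg
    have hgt : g t = (nu T t) ^ α := by
      simp only [hg, nu]
      rw [abs_of_neg (sub_neg.2 hscat), neg_sub]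
    have hpos : 0 < g t := Real.rpow_pos_of_pos (abs_pos.2 (sub_neg.2 hscat).ne) α
    have hLg : L * g t = f t - f r := by
      rw [hL, ← hgt, div_mul_cancel₀ _ hpos.ne']
    have hgc : Continuous g :=
      (continuous_const.sub continuous_id).abs.rpow_const fun _ => Or.inr hα.1.le
    have hε' : 0 < ε * g t / 4 := by positivity
    have h_half : ∀ᶠ s in nhds t, g t / 2 < g s :=
      hgc.continuousAt.eventually (lt_mem_nhds (half_lt_self hpos))
    have h_close : ∀ᶠ s in nhds t, |L * g s - L * g t| < ε * g t / 4 :=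
      (continuous_const.mul hgc).continuousAt.eventually (Metric.ball_mem_nhds _ hε')
    obtain ⟨δ₁, hδ₁, h₁⟩ :=
      Metric.eventually_nhds_iff.1 (h_half.and (h_close.and (lt_mem_nhds hscat)))
    obtain ⟨δ₂, hδ₂, h₂⟩ := hcont _ hε'
    refine ⟨min δ₁ δ₂, lt_min hδ₁ hδ₂, fun s hs => ?_⟩
    rw [Unbhd, if_pos hQ] at hs
    obtain ⟨⟨hs_left, hs_right⟩, hsT⟩ := hs
    have hm₁ := min_le_left δ₁ δ₂
    have hm₂ := min_le_right δ₁ δ₂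
    obtain ⟨hs_half, hs_close, hrs⟩ :=
      h₁ (show dist s t < δ₁ by rw [Real.dist_eq, abs_lt]; constructor <;> linarith)
    have hs_f := h₂ s ⟨⟨by linarith, by linarith⟩, hsT⟩
    rw [fpow_of_neg_of_mem hQ (sub_neg.2 hrs)]
    change |f r - f s - L * -g s| ≤ ε * g s
    calc |f r - f s - L * -g s| = |(f t - f s) + (L * g s - L * g t)| := by
          rw [hLg]; ring_nf
      _ ≤ |f t - f s| + |L * g s - L * g t| := abs_add_le _ _
      _ ≤ ε * (g t / 2) := by linarith
      _ ≤ ε * g s := by gcongr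
  · refine ⟨t - rho T t, sub_pos.2 hscat, fun s hs => ?_⟩
    rw [Unbhd, if_neg hQ, sub_sub_cancel] at hs
    exact absurd (le_rho hs.2 hs.1.2) hs.1.1.not_ge
end

section
/- Let 𝕋 be a time scale, let α ∈ (0,1] with α ∈ Q, and let t ∈ 𝕋^k be left-dense. Then f : 𝕋 → ℝ is nabla fractional differentiable of order α at t if and only if the two-sided limit lim_{s→t, s∈𝕋, s≠t} (f(t) − f(s))/(t − s)^α exists (as a finite real number), where (t − s)^α is the real odd root; in this case ∇^(α)f(t) equals this limit. -/
open Set Filter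
open scoped Classical

theorem abs_oddPow {α x : ℝ} (hx : x ≠ 0) : |oddPow α x| = |x| ^ α := by
  rcases lt_or_gt_of_ne hx with h | h
  · simp [oddPow, Real.sign_of_neg h, abs_of_nonneg (Real.rpow_nonneg (abs_nonneg x) α)]
  · simp [oddPow, Real.sign_of_pos h, abs_of_nonneg (Real.rpow_nonneg (abs_nonneg x) α)]

/-- At a left-dense point, `L` is a nabla fractional derivative of order `α ∈ Q` exactly when the
difference quotients tend to `L`. -/
theorem nablaDiffAt_iff_tendsto {T : Set ℝ} {α t : ℝ} (hα : 0 < α) (hαQ : α ∈ QOdd)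
    (hdense : rho T t = t) (f : ℝ → ℝ) (L : ℝ) :
    nablaDiffAt T α f t L ↔
      Filter.Tendsto (fun s => (f t - f s) / oddPow α (t - s))
        (nhdsWithin t (T \ {t})) (nhds L) := by
  have quotient_sub : ∀ s, s ≠ t → 0 < |t - s| ^ α ∧
      |(f t - f s) / oddPow α (t - s) - L| =
        |(f t - f s) - L * oddPow α (t - s)| / |t - s| ^ α := by
    intro s hs
    have hne : t - s ≠ 0 := sub_ne_zero.mpr hs.symm
    have hpos : 0 < |t - s| ^ α := Real.rpow_pos_of_pos (abs_pos.mpr hne) α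
    have hodd : oddPow α (t - s) ≠ 0 := by
      rw [← abs_pos, abs_oddPow hne]
      exact hpos
    refine ⟨hpos, ?_⟩
    rw [← abs_oddPow hne, ← abs_div, sub_div (f t - f s), mul_div_cancel_right₀ _ hodd]
  have mem_nbhd : ∀ δ s, s ∈ Unbhd T α t δ ↔ dist s t < δ ∧ s ∈ T := by
    intro δ s
    rw [Unbhd, if_pos hαQ, ← Real.ball_eq_Ioo]
    rfl
  simp only [nablaDiffAt, hdense, fpow, if_pos hαQ, mem_nbhd, Metric.tendsto_nhdsWithin_nhds]
  constructor
  · intro h ε hε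
    obtain ⟨δ, hδ, H⟩ := h (ε / 2) (half_pos hε)
    refine ⟨δ, hδ, fun s hs hd => ?_⟩
    obtain ⟨hpos, heq⟩ := quotient_sub s hs.2
    rw [Real.dist_eq, heq]
    exact ((div_le_iff₀ hpos).mpr (H s ⟨hd, hs.1⟩)).trans_lt (half_lt_self hε)
  · intro h ε hε
    obtain ⟨δ, hδ, H⟩ := h ε hε
    refine ⟨δ, hδ, fun s hs => ?_⟩
    rcases eq_or_ne s t with rfl | hst
    · simp [oddPow, Real.zero_rpow hα.ne']
    · obtain ⟨hpos, heq⟩ := quotient_sub s hst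
      have hlt := H ⟨hs.2, hst⟩ hs.1
      rw [Real.dist_eq, heq] at hlt
      exact (div_le_iff₀ hpos).mp hlt.le

/-- For `α ∈ Q` and `t ∈ 𝕋^k` left-dense, `f` is nabla fractional
differentiable of order `α` at `t` iff the two-sided limit of
`(f t - f s)/(t - s)^α` (odd-root power) along `𝕋 \ {t}` exists; and the
derivative equals the limit. -/
theorem stmt3 (T : Set ℝ) (hTne : T.Nonempty) (hTcl : IsClosed T)
    (α : ℝ) (hα : α ∈ Set.Ioc (0 : ℝ) 1) (hαQ : α ∈ QOdd)
    (t : ℝ) (ht : t ∈ Tk T) (hdense : rho T t = t) (f : ℝ → ℝ) :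
    ((∃ L, nablaDiffAt T α f t L) ↔
      ∃ L, Filter.Tendsto (fun s => (f t - f s) / oddPow α (t - s))
        (nhdsWithin t (T \ {t})) (nhds L)) ∧
    (∀ L, nablaDiffAt T α f t L →
      Filter.Tendsto (fun s => (f t - f s) / oddPow α (t - s))
        (nhdsWithin t (T \ {t})) (nhds L)) := by
  have key := nablaDiffAt_iff_tendsto hα.1 hαQ hdense f
  exact ⟨exists_congr key, fun L => (key L).mp⟩
end

section
/- Let 𝕋 be a time scale and α ∈ (0,1]. Let f : ℝ → ℝ be continuously differentiable and let g : 𝕋 → ℝ be continuous at every point of 𝕋^k. If g is nabla fractional differentiable of order α at a left-dense point t ∈ 𝕋^k, then f ∘ g is nabla fractional differentiable of order α at t with ∇^(α)(f ∘ g)(t) = f'(g(t)) · ∇^(α)g(t). -/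
open Set Filter
open scoped Classical

theorem Unbhd_subset (T : Set ℝ) (α t δ : ℝ) : Unbhd T α t δ ⊆ Ioo (t - δ) (t + δ) ∩ T := by
  unfold Unbhd
  split_ifs
  · exact subset_rfl
  · rintro s ⟨⟨h₁, h₂⟩, hs⟩
    exact ⟨⟨h₁, by linarith⟩, hs⟩

/-- The chain rule needs only differentiability of the outer function at `g t` and continuity
of the inner function at `t`. -/
theorem nablaDiffAt.comp_hasDerivAt {T : Set ℝ} {α t G D : ℝ} {f g : ℝ → ℝ}
    (hg : nablaDiffAt T α g t G) (hf : HasDerivAt f D (g t)) (hc : contAt T g t)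
    (hdense : rho T t = t) : nablaDiffAt T α (f ∘ g) t (D * G) := by
  intro ε hε
  set η := ε / (2 * (|D| + 1)) with hη_def
  have hη : 0 < η := by positivity
  set c := ε / (2 * (η + |G|)) with hc_def
  have hc_pos : 0 < c := by positivity
  obtain ⟨r, hr, hfr⟩ := Metric.eventually_nhds_iff.1 (hf.isLittleO.def hc_pos)
  obtain ⟨δ₁, hδ₁, h₁⟩ := hc r hr
  obtain ⟨δ₂, hδ₂, h₂⟩ := hg η hη
  refine ⟨min δ₁ δ₂, lt_min hδ₁ hδ₂, fun s hs => ?_⟩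
  have hgs := h₁ s (Unbhd_subset T α t δ₁ (Unbhd_mono T α t (min_le_left _ _) hs))
  have hGs := h₂ s (Unbhd_mono T α t (min_le_right _ _) hs)
  have hfs : |f (g t) - f (g s) - D * (g t - g s)| ≤ c * |g t - g s| := by
    have h := hfr (y := g s) (by rwa [Real.dist_eq, abs_sub_comm])
    rw [Real.norm_eq_abs, Real.norm_eq_abs, smul_eq_mul, abs_sub_comm (g s)] at h
    rw [← abs_neg]
    convert h using 2
    ring
  rw [hdense] at hGs ⊢
  have hP := abs_fpow_le α (t - s)
  set P := fpow α (t - s)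
  set A := |t - s| ^ α with hA_def
  have hA : 0 ≤ A := Real.rpow_nonneg (abs_nonneg _) α
  have hinc : |g t - g s| ≤ (η + |G|) * A := by
    calc |g t - g s| = |(g t - g s - G * P) + G * P| := by ring_nf
      _ ≤ |g t - g s - G * P| + |G| * |P| := (abs_add_le _ _).trans_eq (by rw [abs_mul])
      _ ≤ η * A + |G| * A := by gcongr
      _ = (η + |G|) * A := by ring
  have hcη : c * (η + |G|) = ε / 2 := by
    rw [hc_def]
    field_simp
  have hDη : |D| * η ≤ ε / 2 := by
    have h : (|D| + 1) * η = ε / 2 := by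
      rw [hη_def]
      field_simp
    linarith
  calc |(f ∘ g) t - (f ∘ g) s - D * G * P|
      = |(f (g t) - f (g s) - D * (g t - g s)) + D * (g t - g s - G * P)| := by
        simp only [Function.comp_apply]
        ring_nf
    _ ≤ |f (g t) - f (g s) - D * (g t - g s)| + |D| * |g t - g s - G * P| :=
        (abs_add_le _ _).trans_eq (by rw [abs_mul])
    _ ≤ c * ((η + |G|) * A) + |D| * (η * A) := by
        gcongr
        exact hfs.trans (by gcongr)
    _ = (c * (η + |G|) + |D| * η) * A := by ring
    _ ≤ ε * A := by
        gcongr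
        linarith

/-- At a left-dense point `t ∈ 𝕋^k`, for `f ∈ C¹(ℝ)` and `g`
continuous on `𝕋^k` and nabla fractional differentiable of order `α` at `t`,
`∇^(α)(f ∘ g)(t) = f'(g(t)) · ∇^(α)g(t)`. -/
theorem stmt14 (T : Set ℝ) (hTne : T.Nonempty) (hTcl : IsClosed T)
    (α : ℝ) (hα : α ∈ Set.Ioc (0 : ℝ) 1)
    (f g : ℝ → ℝ) (hf : ContDiff ℝ 1 f)
    (hgcont : ∀ u ∈ Tk T, contAt T g u)
    (t : ℝ) (ht : t ∈ Tk T) (hdense : rho T t = t)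
    (G : ℝ) (hgdiff : nablaDiffAt T α g t G) :
    nablaDiffAt T α (f ∘ g) t (deriv f (g t) * G) := by
  exact hgdiff.comp_hasDerivAt ((hf.differentiable one_ne_zero) (g t)).hasDerivAt (hgcont t ht)
    hdense
end

section
/- Let 𝕋 be a time scale, α ∈ (0,1], m ≥ 2 an integer, and t ∈ 𝕋^k. Let f₁, …, f_m : 𝕋 → ℝ each be continuous at every point of 𝕋^k and nabla fractional differentiable of order α at t. Then the pointwise product ∏_{i=1}^m f_i is nabla fractional differentiable of order α at t with ∇^(α)(∏_{i=1}^m f_i)(t) = ∑_{i=1}^m [ (∏_{1 ≤ j ≤ i−1} f_j(ρ(t))) · ∇^(α)f_i(t) · (∏_{i+1 ≤ j ≤ m} f_j(t)) ]. -/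
open Set Filter
open scoped Classical

/-- The filter whose basis is formed by the neighborhoods `Unbhd T α t δ`. -/
noncomputable def nablaFilter (T : Set ℝ) (α t : ℝ) : Filter ℝ :=
  if α ∈ QOdd then nhdsWithin t T else nhdsWithin t (Iio t ∩ T)

theorem hasBasis_nablaFilter (T : Set ℝ) (α t : ℝ) :
    (nablaFilter T α t).HasBasis (fun δ : ℝ => 0 < δ) (Unbhd T α t) := by
  by_cases h : α ∈ QOdd
  · have h1 : nablaFilter T α t = nhdsWithin t T := if_pos h
    have h2 : Unbhd T α t = fun δ => Ioo (t - δ) (t + δ) ∩ T := by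
      funext δ
      simp [Unbhd, h]
    rw [h1, h2]
    exact nhdsWithin_hasBasis (nhds_basis_Ioo_pos t) T
  · have h1 : nablaFilter T α t = nhdsWithin t (Iio t ∩ T) := if_neg h
    rw [h1]
    refine (nhdsWithin_hasBasis (nhds_basis_Ioo_pos t) (Iio t ∩ T)).congr
      (fun _ => Iff.rfl) fun δ hδ => ?_
    ext s
    simp only [Unbhd, h, if_false, mem_inter_iff, mem_Ioo, mem_Iio]
    constructor
    · rintro ⟨⟨h1, -⟩, h2, h3⟩
      exact ⟨⟨h1, h2⟩, h3⟩
    · rintro ⟨⟨h1, h2⟩, h3⟩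
      exact ⟨⟨h1, by linarith⟩, h2, h3⟩

theorem nablaDiffAt_iff_isLittleO {T : Set ℝ} {α : ℝ} {f : ℝ → ℝ} {t L : ℝ} :
    nablaDiffAt T α f t L ↔
      (fun s => (f (rho T t) - f s) - L * fpow α (rho T t - s))
        =o[nablaFilter T α t] fun s => |rho T t - s| ^ α := by
  rw [Asymptotics.isLittleO_iff]
  refine forall₂_congr fun ε _ => ?_
  rw [(hasBasis_nablaFilter T α t).eventually_iff]
  simp only [Real.norm_eq_abs, abs_of_nonneg (Real.rpow_nonneg (abs_nonneg _) α)]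

theorem contAt.tendsto_nablaFilter {T : Set ℝ} {f : ℝ → ℝ} {t : ℝ} (h : contAt T f t) (α : ℝ) :
    Tendsto f (nablaFilter T α t) (nhds (f t)) := by
  have hle : nablaFilter T α t ≤ nhdsWithin t T := by
    unfold nablaFilter
    split_ifs
    · exact le_rfl
    · exact nhdsWithin_mono t inter_subset_right
  refine Tendsto.mono_left ?_ hle
  rw [(nhdsWithin_hasBasis (nhds_basis_Ioo_pos t) T).tendsto_iff Metric.nhds_basis_ball]
  intro ε hε
  obtain ⟨δ, hδ, H⟩ := h ε hε
  refine ⟨δ, hδ, fun s hs => ?_⟩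
  rw [Metric.mem_ball, dist_comm, Real.dist_eq]
  exact H s hs

theorem prod_sub_prod_ordered {ι R : Type*} [Fintype ι] [LinearOrder ι] [CommRing R]
    (a b : ι → R) :
    ∏ i, a i - ∏ i, b i =
      ∑ i, (∏ j ∈ Finset.univ.filter (fun j => j < i), a j) * (a i - b i) *
        ∏ j ∈ Finset.univ.filter (fun j => i < j), b j := by
  have h := Finset.prod_sub_ordered Finset.univ b (fun i => b i - a i)
  simp only [sub_sub_cancel] at h
  rw [h, sub_sub_cancel_left, ← Finset.sum_neg_distrib]
  refine Finset.sum_congr rfl fun i _ => ?_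
  ring

/-- Product rule for a finite collection of nabla fractional
differentiable functions. -/
theorem stmt17 (T : Set ℝ) (hTne : T.Nonempty) (hTcl : IsClosed T)
    (α : ℝ) (hα : α ∈ Set.Ioc (0 : ℝ) 1)
    (m : ℕ) (hm : 2 ≤ m)
    (t : ℝ) (ht : t ∈ Tk T)
    (f : Fin m → ℝ → ℝ) (D : Fin m → ℝ)
    (hcont : ∀ i, ∀ u ∈ Tk T, contAt T (f i) u)
    (hdiff : ∀ i, nablaDiffAt T α (f i) t (D i)) :
    nablaDiffAt T α (fun s => ∏ i, f i s) t
      (∑ i, (∏ j ∈ Finset.univ.filter (fun j => j < i), f j (rho T t)) * D i *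
        ∏ j ∈ Finset.univ.filter (fun j => i < j), f j t) := by
  have htend : ∀ i, Tendsto (f i) (nablaFilter T α t) (nhds (f i t)) := fun i =>
    (hcont i t ht).tendsto_nablaFilter α
  have hpow : (fun s => fpow α (rho T t - s)) =O[nablaFilter T α t]
      fun s => |rho T t - s| ^ α :=
    Asymptotics.isBigO_of_le _ fun s => (abs_fpow_le α _).trans (le_abs_self _)
  rw [nablaDiffAt_iff_isLittleO]
  have key : ∀ i, (fun s => (∏ j ∈ Finset.univ.filter (fun j => j < i), f j (rho T t)) *
      (((f i (rho T t) - f i s) - D i * fpow α (rho T t - s)) *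
          (∏ j ∈ Finset.univ.filter (fun j => i < j), f j s) +
        D i * (fpow α (rho T t - s) *
          ((∏ j ∈ Finset.univ.filter (fun j => i < j), f j s) -
            ∏ j ∈ Finset.univ.filter (fun j => i < j), f j t))))
      =o[nablaFilter T α t] fun s => |rho T t - s| ^ α := by
    intro i
    have hB := tendsto_finsetProd (Finset.univ.filter (fun j => i < j)) fun j _ => htend j
    have h1 := (nablaDiffAt_iff_isLittleO.1 (hdiff i)).mul_isBigO (hB.isBigO_one ℝ)
    have h2 := hpow.mul_isLittleO
      ((Asymptotics.isLittleO_one_iff ℝ).2 (tendsto_sub_nhds_zero_iff.2 hB))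
    simp only [mul_one] at h1 h2
    exact (h1.add (h2.const_mul_left (D i))).const_mul_left _
  have hsum := Asymptotics.IsLittleO.fun_sum (s := Finset.univ) fun i _ => key i
  refine hsum.congr_left fun s => ?_
  have htel := prod_sub_prod_ordered (fun i => f i (rho T t)) (fun i => f i s)
  rw [htel, Finset.sum_mul, ← Finset.sum_sub_distrib]
  refine Finset.sum_congr rfl fun i _ => ?_
  ring
end
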